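/- For every ε > 0 there exists a constant C = C(ε) > 0 such that for every positive integer n, the Erdős–Straus equation 4/n = 1/a₁ + 1/a₂ + 1/a₃ has at most C · n^(3/5 + ε) solutions in positive integers a₁, a₂, a₃ with a₁ ≤ a₂ ≤ a₃; that is, f₃(4,n) ≤ C n^(3/5+ε). -/

import Mathlib

/-- `numSols k m n` is the number of nondecreasing `k`-tuples of positive integers
`(a₁, …, a_k)` with `m / n = 1/a₁ + ⋯ + 1/a_k`. -/
noncomputable def numSols (k m n : ℕ) : ℕ :=
  Nat.card {a : Fin k → ℕ // (∀ i, 0 < a i) ∧ Monotone a ∧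
    (m : ℚ) / n = ∑ i, (1 : ℚ) / a i}

theorem param (n a b c : ℕ) (hn : 0 < n) (ha : 0 < a) (hb : 0 < b) (hc : 0 < c)
    (h : (4 : ℚ) / n = 1 / a + 1 / b + 1 / c) :
    ∃ N1 N2 N3 d x y z : ℕ, 0 < d ∧ 0 < x ∧ 0 < y ∧ 0 < z ∧ N1 ∣ n ∧ N2 ∣ n ∧ N3 ∣ n ∧
      a * N1 = n * (d * x * y) ∧ b * N2 = n * (d * x * z) ∧ c * N3 = n * (d * y * z) ∧
      4 * d * x * y * z = N1 * z + N2 * y + N3 * x ∧ Nat.Coprime x N1 := by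
  have key : ∀ a : ℕ, 0 < a → ∃ t N : ℕ, 0 < t ∧ 0 < N ∧ N ∣ n ∧ a * N = n * t ∧ t.Coprime N := by
    intro a ha
    obtain ⟨g, t, N, hg, hco, h1, h2⟩ := Nat.exists_coprime' (Nat.gcd_pos_of_pos_left n ha)
    refine ⟨t, N, ?_, ?_, ⟨_, h2⟩, ?_, hco⟩
    · rcases Nat.eq_zero_or_pos t with h0 | h0
      · simp [h0] at h1; omega
      · exact h0
    · rcases Nat.eq_zero_or_pos N with h0 | h0
      · simp [h0] at h2; omega
      · exact h0
    · rw [h1, h2]; ring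
  obtain ⟨t1, N1, ht1, hN1, hd1, e1, c1⟩ := key a ha
  obtain ⟨t2, N2, ht2, hN2, hd2, e2, c2⟩ := key b hb
  obtain ⟨t3, N3, ht3, hN3, hd3, e3, c3⟩ := key c hc
  have E : 4 * t1 * t2 * t3 = N1 * t2 * t3 + N2 * t1 * t3 + N3 * t1 * t2 := by
    have q1 : (a : ℚ) = n * t1 / N1 := by
      rw [eq_div_iff (by positivity)]; exact_mod_cast e1
    have q2 : (b : ℚ) = n * t2 / N2 := by
      rw [eq_div_iff (by positivity)]; exact_mod_cast e2
    have q3 : (c : ℚ) = n * t3 / N3 := by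
      rw [eq_div_iff (by positivity)]; exact_mod_cast e3
    rw [q1, q2, q3] at h
    have : (0 : ℚ) < n := by positivity
    have : (0 : ℚ) < t1 := by positivity
    have : (0 : ℚ) < t2 := by positivity
    have : (0 : ℚ) < t3 := by positivity
    field_simp at h
    have h' : (4 : ℚ) * t1 * t2 * t3 = N1 * t2 * t3 + N2 * t1 * t3 + N3 * t1 * t2 := by
      linarith
    exact_mod_cast h'
  set d := Nat.gcd t1 (Nat.gcd t2 t3) with hd
  have hdpos : 0 < d := Nat.gcd_pos_of_pos_left _ ht1
  obtain ⟨s1, f1⟩ : d ∣ t1 := Nat.gcd_dvd_left _ _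
  obtain ⟨s2, f2⟩ : d ∣ t2 := (Nat.gcd_dvd_right _ _).trans (Nat.gcd_dvd_left _ _)
  obtain ⟨s3, f3⟩ : d ∣ t3 := (Nat.gcd_dvd_right _ _).trans (Nat.gcd_dvd_right _ _)
  have hg : Nat.gcd s1 (Nat.gcd s2 s3) = 1 := by
    have : d * Nat.gcd s1 (Nat.gcd s2 s3) = d * 1 := by
      rw [← Nat.gcd_mul_left, ← Nat.gcd_mul_left, ← f1, ← f2, ← f3, mul_one]
    exact Nat.eq_of_mul_eq_mul_left hdpos this
  have E' : 4 * d * s1 * s2 * s3 = N1 * s2 * s3 + N2 * s1 * s3 + N3 * s1 * s2 := by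
    have : d ^ 2 * (4 * d * s1 * s2 * s3) = d ^ 2 * (N1 * s2 * s3 + N2 * s1 * s3 + N3 * s1 * s2) := by
      rw [f1, f2, f3] at E
      linarith
    exact Nat.eq_of_mul_eq_mul_left (by positivity) this
  have c1' : s1.Coprime N1 := Nat.Coprime.coprime_dvd_left ⟨d, by rw [f1]; ring⟩ c1
  have c2' : s2.Coprime N2 := Nat.Coprime.coprime_dvd_left ⟨d, by rw [f2]; ring⟩ c2
  have c3' : s3.Coprime N3 := Nat.Coprime.coprime_dvd_left ⟨d, by rw [f3]; ring⟩ c3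
  have D1 : s1 ∣ s2 * s3 := by
    apply c1'.dvd_of_dvd_mul_left
    have : s1 ∣ N1 * (s2 * s3) + s1 * (N2 * s3 + N3 * s2) := ⟨4 * d * s2 * s3, by linarith⟩
    exact (Nat.dvd_add_left (dvd_mul_right _ _)).1 this
  have D2 : s2 ∣ s1 * s3 := by
    apply c2'.dvd_of_dvd_mul_left
    have : s2 ∣ N2 * (s1 * s3) + s2 * (N1 * s3 + N3 * s1) := ⟨4 * d * s1 * s3, by linarith⟩
    exact (Nat.dvd_add_left (dvd_mul_right _ _)).1 this
  have D3 : s3 ∣ s1 * s2 := by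
    apply c3'.dvd_of_dvd_mul_left
    have : s3 ∣ N3 * (s1 * s2) + s3 * (N1 * s2 + N2 * s1) := ⟨4 * d * s1 * s2, by linarith⟩
    exact (Nat.dvd_add_left (dvd_mul_right _ _)).1 this
  have prodform : ∀ u v w : ℕ, u ∣ v * w → Nat.gcd u (Nat.gcd v w) = 1 →
      u = Nat.gcd u v * Nat.gcd u w := by
    intro u v w h1 h2
    apply Nat.dvd_antisymm
    · exact Nat.dvd_gcd_mul_gcd_iff_dvd_mul.2 h1
    · apply Nat.Coprime.mul_dvd_of_dvd_of_dvd _ (Nat.gcd_dvd_left _ _) (Nat.gcd_dvd_left _ _)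
      apply Nat.eq_one_of_dvd_one
      rw [← h2]
      exact Nat.dvd_gcd ((Nat.gcd_dvd_left _ _).trans (Nat.gcd_dvd_left _ _))
        (Nat.dvd_gcd ((Nat.gcd_dvd_left _ _).trans (Nat.gcd_dvd_right _ _))
          ((Nat.gcd_dvd_right _ _).trans (Nat.gcd_dvd_right _ _)))
  have p1 := prodform s1 s2 s3 D1 hg
  have p2 := prodform s2 s1 s3 D2 (by
    rw [← hg, ← Nat.gcd_assoc, ← Nat.gcd_assoc, Nat.gcd_comm s2 s1])
  have p3 := prodform s3 s1 s2 D3 (by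
    rw [← hg, Nat.gcd_comm, Nat.gcd_assoc])
  rw [Nat.gcd_comm s2 s1] at p2
  rw [Nat.gcd_comm s3 s1, Nat.gcd_comm s3 s2] at p3
  have cx : (Nat.gcd s1 s2).Coprime N1 := Nat.Coprime.coprime_dvd_left (Nat.gcd_dvd_left _ _) c1'
  have s1p : 0 < s1 := Nat.pos_of_ne_zero (by rintro rfl; simp at f1; omega)
  have s2p : 0 < s2 := Nat.pos_of_ne_zero (by rintro rfl; simp at f2; omega)
  have hx : 0 < Nat.gcd s1 s2 := Nat.gcd_pos_of_pos_left _ s1p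
  have hy : 0 < Nat.gcd s1 s3 := Nat.gcd_pos_of_pos_left _ s1p
  have hz : 0 < Nat.gcd s2 s3 := Nat.gcd_pos_of_pos_left _ s2p
  generalize Nat.gcd s1 s2 = x at *
  generalize Nat.gcd s1 s3 = y at *
  generalize Nat.gcd s2 s3 = z at *
  refine ⟨N1, N2, N3, d, x, y, z, hdpos, hx, hy, hz, hd1, hd2, hd3, ?_, ?_, ?_, ?_, cx⟩
  · rw [e1, f1, p1]; ring
  · rw [e2, f2, p2]; ring
  · rw [e3, f3, p3]; ring
  · have : (x * y * z) * (4 * d * x * y * z) = (x * y * z) * (N1 * z + N2 * y + N3 * x) := by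
      rw [p1, p2, p3] at E'
      linarith
    exact Nat.eq_of_mul_eq_mul_left (by positivity) this

theorem divisor_bound (δ : ℝ) (hδ : 0 < δ) : ∃ C : ℝ, 0 < C ∧ ∀ k : ℕ, 0 < k →
    (k.divisors.card : ℝ) ≤ C * (k : ℝ) ^ δ := by
  set P : ℕ := ⌈(2 : ℝ) ^ (1 / δ)⌉₊ with hP
  have hl : 0 < Real.log 2 := Real.log_pos (by norm_num)
  set A : ℝ := 1 + 1 / (δ * Real.log 2) with hA
  have hA1 : 1 ≤ A := by
    have : 0 < 1 / (δ * Real.log 2) := by positivity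
    linarith
  refine ⟨A ^ P, by positivity, fun k hk => ?_⟩
  rw [Nat.card_divisors hk.ne']
  have hkk : (k : ℝ) ^ δ = ∏ p ∈ k.primeFactors, ((p : ℝ) ^ (k.factorization p)) ^ δ := by
    conv_lhs => rw [← Nat.prod_factorization_pow_eq_self hk.ne']
    rw [Nat.prod_factorization_eq_prod_primeFactors]
    push_cast
    rw [← Real.finsetProd_rpow _ _ (fun i _ => by positivity)]
  have step : ∀ p ∈ k.primeFactors, ((k.factorization p : ℝ) + 1) ≤
      (if p < P then A else 1) * ((p : ℝ) ^ (k.factorization p)) ^ δ := by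
    intro p hp
    have hp2 : 2 ≤ p := (Nat.prime_of_mem_primeFactors hp).two_le
    have hp2' : (2 : ℝ) ≤ p := by exact_mod_cast hp2
    generalize k.factorization p = e
    rw [← Real.rpow_natCast, ← Real.rpow_mul (by positivity), mul_comm (e : ℝ) δ]
    split_ifs with hlt
    · have h1 : (2 : ℝ) ^ (δ * e) ≤ (p : ℝ) ^ (δ * e) :=
        Real.rpow_le_rpow (by norm_num) hp2' (by positivity)
      have h2 : Real.log 2 * (δ * e) + 1 ≤ (2 : ℝ) ^ (δ * e) := by
        rw [Real.rpow_def_of_pos (by norm_num)]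
        exact Real.add_one_le_exp _
      have h3 : (e : ℝ) + 1 ≤ A * (Real.log 2 * (δ * e) + 1) := by
        have : A * (Real.log 2 * (δ * e) + 1) = (Real.log 2 * (δ * e)) + 1 + e + 1 / (δ * Real.log 2) := by
          rw [hA]; field_simp; ring
        rw [this]
        have : 0 ≤ Real.log 2 * (δ * e) := by positivity
        have : 0 < 1 / (δ * Real.log 2) := by positivity
        linarith
      calc (e : ℝ) + 1 ≤ A * (Real.log 2 * (δ * e) + 1) := h3
        _ ≤ A * (p : ℝ) ^ (δ * e) := by gcongr; linarith
    · have h1 : (2 : ℝ) ^ (1 / δ) ≤ p := (Nat.le_ceil _).trans (by exact_mod_cast not_lt.1 hlt)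
      have h2 : (2 : ℝ) ≤ (p : ℝ) ^ δ := by
        have := Real.rpow_le_rpow (by positivity) h1 hδ.le
        rwa [← Real.rpow_mul (by norm_num), one_div_mul_cancel hδ.ne', Real.rpow_one] at this
      rw [one_mul, Real.rpow_mul (by positivity), Real.rpow_natCast]
      calc (e : ℝ) + 1 ≤ 2 ^ e := by exact_mod_cast Nat.lt_two_pow_self
        _ ≤ _ := by gcongr
  push_cast
  calc ∏ p ∈ k.primeFactors, ((k.factorization p : ℝ) + 1)
      ≤ ∏ p ∈ k.primeFactors, ((if p < P then A else 1) * ((p : ℝ) ^ (k.factorization p)) ^ δ) :=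
        Finset.prod_le_prod (fun i _ => by positivity) step
    _ = (∏ p ∈ k.primeFactors, (if p < P then A else 1)) * (k : ℝ) ^ δ := by
        rw [Finset.prod_mul_distrib, hkk]
    _ ≤ _ := by
        gcongr
        rw [Finset.prod_ite, Finset.prod_const, Finset.prod_const_one, mul_one]
        apply pow_le_pow_right₀ hA1
        calc _ ≤ (Finset.range P).card := Finset.card_le_card (by
                intro p hp
                simp at hp ⊢
                exact hp.2)
          _ = P := by simp

/-- Recover the solution triple from the parameters. -/
def asm (n N1 N2 N3 d x y z : ℕ) : Fin 3 → ℕ :=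
  ![n * (d * x * y) / N1, n * (d * x * z) / N2, n * (d * y * z) / N3]

/-- Union of `F` over three divisors of `n` and a parameter `q ≤ K`. -/
def outer (n K : ℕ) (F : ℕ → ℕ → ℕ → ℕ → Finset (Fin 3 → ℕ)) : Finset (Fin 3 → ℕ) :=
  n.divisors.biUnion fun N1 => n.divisors.biUnion fun N2 => n.divisors.biUnion fun N3 =>
    (Finset.Icc 1 K).biUnion fun q => F N1 N2 N3 q

def famW (n N1 N2 N3 w : ℕ) : Finset (Fin 3 → ℕ) :=
  (w + N1).divisors.biUnion fun d => (w + N1).divisors.biUnion fun x =>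
    (w + N1).divisors.image fun y => asm n N1 N2 N3 d x y ((N2 * y + N3 * x) / w)

def famV (n N1 N2 N3 q : ℕ) : Finset (Fin 3 → ℕ) :=
  (Nat.gcd N1 N2 * q + N3).divisors.biUnion fun d =>
    (Nat.gcd N1 N2 * q + N3).divisors.biUnion fun y =>
    (Nat.gcd N1 N2 * q + N3).divisors.image fun z =>
      asm n N1 N2 N3 d ((N1 * z + N2 * y) / (Nat.gcd N1 N2 * q)) y z

def famD (n N1 N2 N3 q : ℕ) : Finset (Fin 3 → ℕ) :=
  q.divisors.biUnion fun d =>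
    (4 * q * (q / d) * N3 + N1 * N2).divisors.image fun w =>
      asm n N1 N2 N3 d (q / d) ((w + N1) / (4 * q))
        ((N2 * ((w + N1) / (4 * q)) + N3 * (q / d)) / w)

def famX (n N1 N2 N3 q : ℕ) : Finset (Fin 3 → ℕ) :=
  q.divisors.biUnion fun x =>
    (N2 * (q / x) + N3 * x).divisors.image fun z =>
      asm n N1 N2 N3 ((N1 * z + N2 * (q / x) + N3 * x) / (4 * x * (q / x) * z)) x (q / x) z

theorem outer_card (n K T B : ℕ) (F : ℕ → ℕ → ℕ → ℕ → Finset (Fin 3 → ℕ))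
    (hT : n.divisors.card ≤ T)
    (hF : ∀ N1 N2 N3 q, N1 ≤ n → N2 ≤ n → N3 ≤ n → q ≤ K → (F N1 N2 N3 q).card ≤ B) :
    (outer n K F).card ≤ T * (T * (T * (K * B))) := by
  unfold outer
  refine (Finset.card_biUnion_le_card_mul _ _ (T * (T * (K * B))) fun N1 h1 => ?_).trans
    (Nat.mul_le_mul_right _ hT)
  refine (Finset.card_biUnion_le_card_mul _ _ (T * (K * B)) fun N2 h2 => ?_).trans
    (Nat.mul_le_mul_right _ hT)
  refine (Finset.card_biUnion_le_card_mul _ _ (K * B) fun N3 h3 => ?_).trans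
    (Nat.mul_le_mul_right _ hT)
  refine (Finset.card_biUnion_le_card_mul _ _ B fun q hq => ?_).trans
    (Nat.mul_le_mul_right _ (by simp))
  exact hF _ _ _ _ (Nat.divisor_le h1) (Nat.divisor_le h2) (Nat.divisor_le h3)
    (Finset.mem_Icc.1 hq).2

theorem mem_outer (n K : ℕ) (F : ℕ → ℕ → ℕ → ℕ → Finset (Fin 3 → ℕ)) (hn : 0 < n)
    (N1 N2 N3 q : ℕ) (h1 : N1 ∣ n) (h2 : N2 ∣ n) (h3 : N3 ∣ n) (hq : 0 < q) (hqK : q ≤ K)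
    (a : Fin 3 → ℕ) (ha : a ∈ F N1 N2 N3 q) : a ∈ outer n K F := by
  unfold outer
  simp only [Finset.mem_biUnion, Nat.mem_divisors, Finset.mem_Icc]
  exact ⟨N1, ⟨h1, hn.ne'⟩, N2, ⟨h2, hn.ne'⟩, N3, ⟨h3, hn.ne'⟩, q, ⟨hq, hqK⟩, ha⟩

theorem tri_card {α : Type*} [DecidableEq α] (S : Finset ℕ) (T : ℕ) (hS : S.card ≤ T)
    (f : ℕ → ℕ → ℕ → α) :
    (S.biUnion fun a => S.biUnion fun b => S.image fun c => f a b c).card ≤ T * (T * T) := by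
  refine (Finset.card_biUnion_le_card_mul _ _ (T * T) fun a _ => ?_).trans
    (Nat.mul_le_mul_right _ hS)
  refine (Finset.card_biUnion_le_card_mul _ _ T fun b _ => ?_).trans
    (Nat.mul_le_mul_right _ hS)
  exact Finset.card_image_le.trans hS

set_option maxHeartbeats 2000000 in
theorem core (n K T : ℕ) (hn : 0 < n) (hK : 3 * n ^ 3 < (K + 1) ^ 5) (hKn : K ≤ 2 * n)
    (hT : ∀ k ≤ 100 * n ^ 3, k.divisors.card ≤ T) :
    numSols 3 4 n ≤ 4 * K * T ^ 6 := by
  have hT1 : 1 ≤ T := by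
    have h0 : 0 < n ^ 3 := by positivity
    have := hT 1 (by omega)
    simpa using this
  have hn1 : n ≤ n ^ 3 := Nat.le_self_pow (by norm_num) n
  have hn2 : n ^ 2 ≤ n ^ 3 := Nat.pow_le_pow_right hn (by norm_num)
  have hTn : n.divisors.card ≤ T := hT n (by omega)
  have cW : (outer n K (famW n)).card ≤ T * (T * (T * (K * (T * (T * T))))) := by
    apply outer_card _ _ _ _ _ hTn
    intro N1 N2 N3 q h1 h2 h3 hq
    exact tri_card _ _ (hT _ (by omega)) _
  have cV : (outer n K (famV n)).card ≤ T * (T * (T * (K * (T * (T * T))))) := by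
    apply outer_card _ _ _ _ _ hTn
    intro N1 N2 N3 q h1 h2 h3 hq
    refine tri_card _ _ (hT _ ?_) _
    have : Nat.gcd N1 N2 ≤ n := by
      rcases Nat.eq_zero_or_pos N1 with h0 | h0
      · subst h0; simpa using h2
      · exact (Nat.gcd_le_left _ h0).trans h1
    have : Nat.gcd N1 N2 * q ≤ n * (2 * n) := Nat.mul_le_mul this (hq.trans hKn)
    nlinarith
  have two : T * T ≤ T * (T * T) := by nlinarith [Nat.zero_le (T * T)]
  have cD : (outer n K (famD n)).card ≤ T * (T * (T * (K * (T * (T * T))))) := by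
    apply outer_card _ _ _ _ _ hTn
    intro N1 N2 N3 q h1 h2 h3 hq
    refine le_trans ?_ two
    refine (Finset.card_biUnion_le_card_mul _ _ T fun d _ => ?_).trans
      (Nat.mul_le_mul_right _ (hT _ (by omega)))
    refine Finset.card_image_le.trans (hT _ ?_)
    have e1 : q / d ≤ 2 * n := (Nat.div_le_self _ _).trans (by omega)
    have e2 : 4 * q * (q / d) * N3 ≤ 4 * (2 * n) * (2 * n) * n := by gcongr; omega
    have e3 : N1 * N2 ≤ n * n := Nat.mul_le_mul h1 h2
    nlinarith
  have cX : (outer n K (famX n)).card ≤ T * (T * (T * (K * (T * (T * T))))) := by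
    apply outer_card _ _ _ _ _ hTn
    intro N1 N2 N3 q h1 h2 h3 hq
    refine le_trans ?_ two
    refine (Finset.card_biUnion_le_card_mul _ _ T fun x hx => ?_).trans
      (Nat.mul_le_mul_right _ (hT _ (by omega)))
    refine Finset.card_image_le.trans (hT _ ?_)
    have e1 : q / x ≤ 2 * n := (Nat.div_le_self _ _).trans (by omega)
    have e4 : x ≤ 2 * n := (Nat.divisor_le hx).trans (by omega)
    have e2 : N2 * (q / x) ≤ n * (2 * n) := Nat.mul_le_mul h2 e1
    have e3 : N3 * x ≤ n * (2 * n) := Nat.mul_le_mul h3 e4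
    nlinarith
  set U := outer n K (famW n) ∪ outer n K (famV n) ∪ outer n K (famD n) ∪ outer n K (famX n)
    with hU
  have cU : U.card ≤ 4 * K * T ^ 6 := by
    have u1 := Finset.card_union_le (outer n K (famW n) ∪ outer n K (famV n) ∪ outer n K (famD n))
      (outer n K (famX n))
    have u2 := Finset.card_union_le (outer n K (famW n) ∪ outer n K (famV n)) (outer n K (famD n))
    have u3 := Finset.card_union_le (outer n K (famW n)) (outer n K (famV n))
    have e : 4 * K * T ^ 6 = 4 * (T * (T * (T * (K * (T * (T * T)))))) := by ring
    rw [e, hU]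
    omega
  refine le_trans ?_ cU
  have sub : {a : Fin 3 → ℕ | (∀ i, 0 < a i) ∧ Monotone a ∧
      ((4 : ℕ) : ℚ) / n = ∑ i, (1 : ℚ) / a i} ⊆ (U : Set (Fin 3 → ℕ)) := by
    rintro a ⟨hpos, hmono, heq⟩
    have m1 : a 0 ≤ a 1 := hmono (by decide)
    have m2 : a 1 ≤ a 2 := hmono (by decide)
    rw [Fin.sum_univ_three] at heq
    obtain ⟨N1, N2, N3, d, x, y, z, hd, hx, hy, hz, d1, d2, d3, e1, e2, e3, E, hco⟩ :=
      param n (a 0) (a 1) (a 2) hn (hpos 0) (hpos 1) (hpos 2) (by exact_mod_cast heq)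
    have n1 : 0 < N1 := Nat.pos_of_dvd_of_pos d1 hn
    have n2 : 0 < N2 := Nat.pos_of_dvd_of_pos d2 hn
    have n3 : 0 < N3 := Nat.pos_of_dvd_of_pos d3 hn
    have hasm : a = asm n N1 N2 N3 d x y z := by
      funext i
      fin_cases i
      · show a 0 = n * (d * x * y) / N1
        rw [← e1, Nat.mul_div_cancel _ n1]
      · show a 1 = n * (d * x * z) / N2
        rw [← e2, Nat.mul_div_cancel _ n2]
      · show a 2 = n * (d * y * z) / N3
        rw [← e3, Nat.mul_div_cancel _ n3]
    have o1 : N2 * y ≤ N1 * z := by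
      have h : (n * d * x) * (N2 * y) ≤ (n * d * x) * (N1 * z) := by
        calc (n * d * x) * (N2 * y) = (a 0 * N1) * N2 := by rw [e1]; ring
          _ ≤ (a 1 * N1) * N2 := by gcongr
          _ = (a 1 * N2) * N1 := by ring
          _ = _ := by rw [e2]; ring
      exact Nat.le_of_mul_le_mul_left h (by positivity)
    have o2 : N3 * x ≤ N2 * y := by
      have h : (n * d * z) * (N3 * x) ≤ (n * d * z) * (N2 * y) := by
        calc (n * d * z) * (N3 * x) = (a 1 * N2) * N3 := by rw [e2]; ring
          _ ≤ (a 2 * N2) * N3 := by gcongr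
          _ = (a 2 * N3) * N2 := by ring
          _ = _ := by rw [e3]; ring
      exact Nat.le_of_mul_le_mul_left h (by positivity)
    -- w
    obtain ⟨w, hw⟩ : ∃ w, 4 * (d * x * y) = w + N1 := by
      have : N1 ≤ 4 * (d * x * y) := by
        apply Nat.le_of_mul_le_mul_right _ hz
        have : 4 * (d * x * y) * z = N1 * z + N2 * y + N3 * x := by rw [← E]; ring
        rw [this]; omega
      exact ⟨4 * (d * x * y) - N1, by omega⟩
    have hwz : w * z = N2 * y + N3 * x := by
      have : (w + N1) * z = N1 * z + N2 * y + N3 * x := by rw [← hw, ← E]; ring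
      rw [add_mul] at this; omega
    have hwpos : 0 < w := by
      rcases Nat.eq_zero_or_pos w with h | h
      · have : 0 < N2 * y := by positivity
        rw [h] at hwz; omega
      · exact h
    -- v
    obtain ⟨v, hv⟩ : ∃ v, 4 * (d * y * z) = v + N3 := by
      have : N3 ≤ 4 * (d * y * z) := by
        apply Nat.le_of_mul_le_mul_right _ hx
        have : 4 * (d * y * z) * x = N1 * z + N2 * y + N3 * x := by rw [← E]; ring
        rw [this]; omega
      exact ⟨4 * (d * y * z) - N3, by omega⟩
    have hvx : v * x = N1 * z + N2 * y := by
      have : (v + N3) * x = N1 * z + N2 * y + N3 * x := by rw [← hv, ← E]; ring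
      rw [add_mul] at this; omega
    have hvpos : 0 < v := by
      rcases Nat.eq_zero_or_pos v with h | h
      · have : 0 < N2 * y := by positivity
        rw [h] at hvx; omega
      · exact h
    obtain ⟨q, hq⟩ : Nat.gcd N1 N2 ∣ v := by
      have c : (Nat.gcd N1 N2).Coprime x :=
        Nat.Coprime.coprime_dvd_left (Nat.gcd_dvd_left _ _) hco.symm
      apply c.dvd_of_dvd_mul_right
      rw [hvx]
      exact dvd_add ((Nat.gcd_dvd_left _ _).mul_right _) ((Nat.gcd_dvd_right _ _).mul_right _)
    have hqpos : 0 < q := Nat.pos_of_ne_zero (by rintro rfl; simp at hq; omega)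
    -- the main inequality
    have main : w * q * (d * x) ^ 2 * (x * y) ≤ 3 * n ^ 3 := by
      have i1 : w * z ≤ 2 * (N2 * y) := by omega
      have i2 : v * x ≤ 2 * (N1 * z) := by omega
      have hh : 0 < Nat.gcd N1 N2 := Nat.gcd_pos_of_pos_left _ n1
      have i3 : w * q * x ≤ 4 * n * y := by
        have hl : Nat.lcm N1 N2 ≤ n := Nat.le_of_dvd hn (Nat.lcm_dvd d1 d2)
        have h : (Nat.gcd N1 N2 * z) * (w * q * x) ≤ (Nat.gcd N1 N2 * z) * (4 * n * y) := by
          calc (Nat.gcd N1 N2 * z) * (w * q * x) = (w * z) * (v * x) := by rw [hq]; ring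
            _ ≤ (2 * (N2 * y)) * (2 * (N1 * z)) := Nat.mul_le_mul i1 i2
            _ = 4 * (N1 * N2) * y * z := by ring
            _ = 4 * (Nat.gcd N1 N2 * Nat.lcm N1 N2) * y * z := by rw [Nat.gcd_mul_lcm]
            _ ≤ 4 * (Nat.gcd N1 N2 * n) * y * z := by gcongr
            _ = _ := by ring
        exact Nat.le_of_mul_le_mul_left h (by positivity)
      have i4 : 4 * (d * x * y) ≤ 3 * n := by
        have h : 4 * (d * x * y) ≤ 3 * N1 := by
          apply Nat.le_of_mul_le_mul_right _ hz
          have : 4 * (d * x * y) * z = N1 * z + N2 * y + N3 * x := by rw [← E]; ring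
          rw [this, mul_assoc]; omega
        have := Nat.le_of_dvd hn d1
        omega
      have i5 : 16 * (d * x * y) ^ 2 ≤ 9 * n ^ 2 := by nlinarith
      calc w * q * (d * x) ^ 2 * (x * y) = (w * q * x) * (d ^ 2 * x ^ 2 * y) := by ring
        _ ≤ (4 * n * y) * (d ^ 2 * x ^ 2 * y) := by gcongr
        _ = (4 * n) * (d * x * y) ^ 2 := by ring
        _ ≤ 3 * n ^ 3 := by nlinarith
    have cases4 : w ≤ K ∨ q ≤ K ∨ d * x ≤ K ∨ x * y ≤ K := by
      by_contra hcon
      push Not at hcon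
      obtain ⟨k1, k2, k3, k4⟩ := hcon
      have : (K + 1) ^ 5 ≤ w * q * (d * x) ^ 2 * (x * y) := by
        calc (K + 1) ^ 5 = (K + 1) * (K + 1) * (K + 1) ^ 2 * (K + 1) := by ring
          _ ≤ _ := by gcongr <;> omega
      omega
    simp only [hU, Finset.coe_union, Set.mem_union, Finset.mem_coe]
    rcases cases4 with h | h | h | h
    · refine Or.inl (Or.inl (Or.inl ?_))
      refine mem_outer n K _ hn N1 N2 N3 w d1 d2 d3 hwpos h a ?_
      unfold famW
      simp only [Finset.mem_biUnion, Nat.mem_divisors, Finset.mem_image]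
      refine ⟨d, ⟨⟨4 * x * y, by rw [← hw]; ring⟩, by omega⟩, x,
        ⟨⟨4 * d * y, by rw [← hw]; ring⟩, by omega⟩, y,
        ⟨⟨4 * d * x, by rw [← hw]; ring⟩, by omega⟩, ?_⟩
      rw [← hwz, Nat.mul_div_cancel_left _ hwpos, hasm]
    · refine Or.inl (Or.inl (Or.inr ?_))
      refine mem_outer n K _ hn N1 N2 N3 q d1 d2 d3 hqpos h a ?_
      unfold famV
      simp only [Finset.mem_biUnion, Nat.mem_divisors, Finset.mem_image]
      rw [← hq]
      refine ⟨d, ⟨⟨4 * y * z, by rw [← hv]; ring⟩, by omega⟩, y,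
        ⟨⟨4 * d * z, by rw [← hv]; ring⟩, by omega⟩, z,
        ⟨⟨4 * d * y, by rw [← hv]; ring⟩, by omega⟩, ?_⟩
      rw [← hvx, Nat.mul_div_cancel_left _ hvpos, hasm]
    · refine Or.inl (Or.inr ?_)
      refine mem_outer n K _ hn N1 N2 N3 (d * x) d1 d2 d3 (by positivity) h a ?_
      unfold famD
      simp only [Finset.mem_biUnion, Nat.mem_divisors, Finset.mem_image]
      refine ⟨d, ⟨⟨x, rfl⟩, by positivity⟩, w, ⟨?_, ?_⟩, ?_⟩
      · rw [Nat.mul_div_cancel_left _ hd]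
        refine Int.natCast_dvd_natCast.1 ⟨4 * (d * x) * z - N2, ?_⟩
        have hwz' : (w : ℤ) * z = N2 * y + N3 * x := by exact_mod_cast hwz
        have hw' : (4 : ℤ) * (d * x * y) = w + N1 := by exact_mod_cast hw
        push_cast
        linear_combination (-4 * (d : ℤ) * x) * hwz' - (N2 : ℤ) * hw'
      · positivity
      · have hY : (w + N1) / (4 * (d * x)) = y := by
          rw [← hw, show 4 * (d * x * y) = 4 * (d * x) * y by ring,
            Nat.mul_div_cancel_left _ (by positivity)]
        rw [hY, Nat.mul_div_cancel_left _ hd, ← hwz, Nat.mul_div_cancel_left _ hwpos, hasm]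
    · refine Or.inr ?_
      refine mem_outer n K _ hn N1 N2 N3 (x * y) d1 d2 d3 (by positivity) h a ?_
      unfold famX
      simp only [Finset.mem_biUnion, Nat.mem_divisors, Finset.mem_image]
      refine ⟨x, ⟨⟨y, rfl⟩, by positivity⟩, z, ?_⟩
      rw [Nat.mul_div_cancel_left _ hx]
      refine ⟨⟨⟨w, by rw [← hwz]; ring⟩, by positivity⟩, ?_⟩
      rw [← E, show 4 * d * x * y * z = (4 * x * y * z) * d by ring,
        Nat.mul_div_cancel_left _ (by positivity), hasm]
  have := Set.ncard_le_ncard sub (Finset.finite_toSet U)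
  rw [Set.ncard_coe_finset] at this
  exact this

theorem stmt_1 : ∀ ε : ℝ, 0 < ε → ∃ C : ℝ, 0 < C ∧
    ∀ n : ℕ, 0 < n →
      (numSols 3 4 n : ℝ) ≤ C * (n : ℝ) ^ ((3 : ℝ) / 5 + ε) := by
  intro ε hε
  obtain ⟨C, hC, hdiv⟩ := divisor_bound (ε / 18) (by positivity)
  refine ⟨8 * (C * (100 : ℝ) ^ (ε / 18)) ^ 6, by positivity, fun n hn => ?_⟩
  have hnR : (1 : ℝ) ≤ n := by exact_mod_cast hn
  have hn0 : (0 : ℝ) ≤ n := by positivity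
  set R : ℝ := (n : ℝ) ^ ((3 : ℝ) / 5) with hR
  have hR0 : 0 < R := by positivity
  have hR5 : R ^ 5 = (n : ℝ) ^ 3 := by
    rw [hR, ← Real.rpow_natCast, ← Real.rpow_mul hn0, ← Real.rpow_natCast]
    norm_num
  have hRn : R ≤ n := by
    calc R ≤ (n : ℝ) ^ (1 : ℝ) := Real.rpow_le_rpow_of_exponent_le hnR (by norm_num)
      _ = n := Real.rpow_one _
  set X : ℝ := C * ((100 * n ^ 3 : ℕ) : ℝ) ^ (ε / 18) with hX
  have hX0 : 0 ≤ X := by positivity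
  have hc := core n ⌊2 * R⌋₊ ⌊X⌋₊ hn ?_ ?_ ?_
  · have h1 : (numSols 3 4 n : ℝ) ≤ 4 * ⌊2 * R⌋₊ * (⌊X⌋₊ : ℝ) ^ 6 := by exact_mod_cast hc
    have hXe : X ^ 6 = (C * (100 : ℝ) ^ (ε / 18)) ^ 6 * (n : ℝ) ^ ε := by
      rw [hX]
      push_cast
      rw [Real.mul_rpow (by norm_num) (by positivity), ← mul_assoc, mul_pow]
      congr 1
      rw [← Real.rpow_natCast, ← Real.rpow_natCast, ← Real.rpow_mul hn0, ← Real.rpow_mul hn0]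
      congr 1
      push_cast
      ring
    calc (numSols 3 4 n : ℝ) ≤ 4 * ⌊2 * R⌋₊ * (⌊X⌋₊ : ℝ) ^ 6 := h1
      _ ≤ 4 * (2 * R) * X ^ 6 := by
          gcongr
          · exact Nat.floor_le (by positivity)
          · exact Nat.floor_le hX0
      _ = _ := by
          rw [hXe, Real.rpow_add (by positivity), ← hR]; ring
  · have h1 : 2 * R < ⌊2 * R⌋₊ + 1 := Nat.lt_floor_add_one _
    have h2 : (2 * R) ^ 5 < ((⌊2 * R⌋₊ : ℝ) + 1) ^ 5 := by gcongr
    rw [mul_pow, hR5] at h2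
    have h3 : (3 : ℝ) * n ^ 3 < ((⌊2 * R⌋₊ : ℝ) + 1) ^ 5 := by
      have : (0 : ℝ) < (n : ℝ) ^ 3 := by positivity
      linarith
    exact_mod_cast h3
  · have : ⌊2 * R⌋₊ ≤ ⌊((2 * n : ℕ) : ℝ)⌋₊ := Nat.floor_le_floor (by push_cast; linarith)
    rwa [Nat.floor_natCast] at this
  · intro k hk
    apply Nat.le_floor
    rcases Nat.eq_zero_or_pos k with h0 | h0
    · subst h0; simpa using hX0
    · refine (hdiv k h0).trans ?_
      rw [hX]
      gcongr
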